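/- Let ζ be an initial segment of I, X ∈ Pe(ζ), and ξ an initial segment of I with ξ ⊆ ζ. Then X↾ξ ∈ Pe(ξ). -/

import Mathlib

open Set

abbrev Cantor : Type := ℕ → Bool

section
variable {I : Type}

/-- Restriction of a point of `D^η` to `D^ξ` (for `ξ ⊆ η`). -/
def restrictFn {ξ η : Set I} (h : ξ ⊆ η) (x : ↥η → Cantor) : ↥ξ → Cantor :=
  fun j => x ⟨j.1, h j.2⟩

/-- Projection `X↾ξ` of a set `X ⊆ D^η`. -/
def resSet {ξ η : Set I} (h : ξ ⊆ η) (X : Set (↥η → Cantor)) : Set (↥ξ → Cantor) :=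
  restrictFn h '' X

/-- Inverse projection `Y↾⁻¹η` of a set `Y ⊆ D^ξ`. -/
def resPre {ξ η : Set I} (h : ξ ⊆ η) (Y : Set (↥ξ → Cantor)) : Set (↥η → Cantor) :=
  {y | restrictFn h y ∈ Y}

/-- `A` is (relatively) open in `B`. -/
def RelOpen {α : Type*} [TopologicalSpace α] (A B : Set α) : Prop :=
  ∃ U, IsOpen U ∧ A = U ∩ B

/-- `A` is (relatively) closed in `B`. -/
def RelClosed {α : Type*} [TopologicalSpace α] (A B : Set α) : Prop :=
  ∃ U, IsClosed U ∧ A = U ∩ B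

/-- `A` is (relatively) clopen in `B`. -/
def RelClopen {α : Type*} [TopologicalSpace α] (A B : Set α) : Prop :=
  RelOpen A B ∧ RelClosed A B

open Classical in
/-- The union `x ∪ y` of two partial points agreeing on the common domain. -/
noncomputable def glue {ξ η : Set I} (x : ↥ξ → Cantor) (y : ↥η → Cantor) :
    ↥(ξ ∪ η) → Cantor :=
  fun j => if h : j.1 ∈ ξ then x ⟨j.1, h⟩
           else y ⟨j.1, ((Set.mem_union j.1 ξ η).mp j.2).resolve_left h⟩

variable [PartialOrder I]

/-- `[<i]`. -/
def seg (i : I) : Set I := {j | j < i}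

/-- `[≤i]`. -/
def segLe (i : I) : Set I := {j | j ≤ i}

/-- `[≯i]`. -/
def segNG (i : I) : Set I := {j | ¬ i < j}

lemma seg_subset {ζ : Set I} (hζ : IsLowerSet ζ) {i : I} (hi : i ∈ ζ) : seg i ⊆ ζ :=
  fun _ hj => hζ (le_of_lt hj) hi

lemma segLe_subset {ζ : Set I} (hζ : IsLowerSet ζ) {i : I} (hi : i ∈ ζ) : segLe i ⊆ ζ :=
  fun _ hj => hζ hj hi

lemma isLowerSet_segLe (i : I) : IsLowerSet (segLe i) :=
  fun _ _ hba ha => le_trans hba ha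

lemma seg_subset_segLe (i : I) : seg i ⊆ segLe i :=
  fun _ hj => le_of_lt hj

lemma mem_segLe_self (i : I) : i ∈ segLe i := le_refl i

/-- `D_{Xz}(i) = {x(i) : x ∈ X, x↾(<i) = z}`. -/
def Dxz {ζ : Set I} (X : Set (↥ζ → Cantor)) {i : I} (hi : i ∈ ζ) (h : seg i ⊆ ζ)
    (z : ↥(seg i) → Cantor) : Set Cantor :=
  {c | ∃ x ∈ X, restrictFn h x = z ∧ x ⟨i, hi⟩ = c}

/-- Pre-conditions `IPe(ζ)`. -/
def IPe (ζ : Set I) (hζ : IsLowerSet ζ) (X : Set (↥ζ → Cantor)) : Prop :=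
  -- P-1
  (IsClosed X ∧ X.Nonempty) ∧
  -- P-2
  (∀ (i : I) (hi : i ∈ ζ), ∀ z ∈ resSet (seg_subset hζ hi) X,
      Perfect (Dxz X hi (seg_subset hζ hi) z)) ∧
  -- P-3
  (∀ (i : I) (hi : i ∈ ζ), ∀ G : Set Cantor, IsOpen G →
      RelOpen
        ({z | ∃ x ∈ X, x ⟨i, hi⟩ ∈ G ∧ restrictFn (seg_subset hζ hi) x = z} :
          Set (↥(seg i) → Cantor))
        (resSet (seg_subset hζ hi) X)) ∧
  -- P-4
  (∀ ξ η : Set I, IsLowerSet ξ → IsLowerSet η → ∀ (hξ : ξ ⊆ ζ) (hη : η ⊆ ζ),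
      ∀ x ∈ resSet hξ X, ∀ y ∈ resSet hη X,
        restrictFn (Set.inter_subset_left : ξ ∩ η ⊆ ξ) x =
          restrictFn (Set.inter_subset_right : ξ ∩ η ⊆ η) y →
        glue x y ∈ resSet (Set.union_subset hξ hη) X)

/-- `stem(A)`: the length of the longest common initial segment of members of `A`. -/
noncomputable def stem (A : Set Cantor) : ℕ :=
  sInf {n | ∃ a ∈ A, ∃ b ∈ A, a n ≠ b n}

/-- `Spl(A,e)` for `A ⊆ D`. -/
def SplD (A : Set Cantor) (e : Bool) : Set Cantor :=
  {a ∈ A | a (stem A) = e}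

/-- `Spl(X,i,e)` for `X ⊆ D^ζ`. -/
def Spl {ζ : Set I} (hζ : IsLowerSet ζ) (X : Set (↥ζ → Cantor)) {i : I} (hi : i ∈ ζ)
    (e : Bool) : Set (↥ζ → Cantor) :=
  {x ∈ X |
    x ⟨i, hi⟩ ∈
      SplD (Dxz X hi (seg_subset hζ hi) (restrictFn (seg_subset hζ hi) x)) e}

/-- A `ζ`-admissible function: `Φ : ω → ζ` taking each value of `ζ` infinitely often. -/
def Admissible (ζ : Set I) (Φ : ℕ → I) : Prop :=
  (∀ n, Φ n ∈ ζ) ∧ ∀ i ∈ ζ, ∀ N : ℕ, ∃ n, N ≤ n ∧ Φ n = i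

/-- The sets `X_Φ[u]` for finite binary sequences `u`. -/
def XPhi {ζ : Set I} (hζ : IsLowerSet ζ) (Φ : ℕ → I) (hΦ : ∀ n, Φ n ∈ ζ)
    (X : Set (↥ζ → Cantor)) : (m : ℕ) → (Fin m → Bool) → Set (↥ζ → Cantor)
  | 0, _ => X
  | m + 1, u =>
      Spl hζ (XPhi hζ Φ hΦ X m (fun k => u k.castSucc)) (hΦ m) (u (Fin.last m))

/-- `X` is shrinkable: each `X_Φ[a]` is a singleton. -/
def Shrinkable {ζ : Set I} (hζ : IsLowerSet ζ) (X : Set (↥ζ → Cantor)) : Prop :=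
  ∀ (Φ : ℕ → I) (hΦ : Admissible ζ Φ) (a : ℕ → Bool),
    ∃ x, (⋂ m : ℕ, XPhi hζ Φ hΦ.1 X m (fun k => a k.1)) = {x}

/-- Conditions `Pe(ζ)`: shrinkable pre-conditions. -/
def Pe (ζ : Set I) (hζ : IsLowerSet ζ) (X : Set (↥ζ → Cantor)) : Prop :=
  IPe ζ hζ X ∧ Shrinkable hζ X

/-- `Perf = Pe(I)`. -/
def Perf (X : Set (↥(Set.univ : Set I) → Cantor)) : Prop :=
  Pe Set.univ isLowerSet_univ X

/-- The initial segments `ξ[u,v]`. -/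
def xiUV (Φ : ℕ → I) : (m : ℕ) → (Fin m → Bool) → (Fin m → Bool) → Set I
  | 0, _, _ => Set.univ
  | m + 1, u, v =>
      if u (Fin.last m) = v (Fin.last m) then
        xiUV Φ m (fun k => u k.castSucc) (fun k => v k.castSucc)
      else
        xiUV Φ m (fun k => u k.castSucc) (fun k => v k.castSucc) ∩ segNG (Φ m)

/-- A `Φ`-splitting system of order `m`. -/
def SplittingSystem (Φ : ℕ → I) (m : ℕ)
    (X : (n : ℕ) → (Fin n → Bool) → Set (↥(Set.univ : Set I) → Cantor)) : Prop :=
  (∀ n, n ≤ m → ∀ u : Fin n → Bool, Perf (X n u)) ∧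
  -- S-1
  (∀ n, n < m → ∀ (u : Fin n → Bool) (e : Bool),
      X (n + 1) (Fin.snoc u e) ⊆
        Spl isLowerSet_univ (X n u) (Set.mem_univ (Φ n)) e) ∧
  -- S-2
  (∀ n, n ≤ m → ∀ u v : Fin n → Bool,
      resSet (Set.subset_univ (xiUV Φ n u v)) (X n u) =
        resSet (Set.subset_univ (xiUV Φ n u v)) (X n v)) ∧
  -- S-3
  (∀ n, n ≤ m → ∀ u v : Fin n → Bool, ∀ i : I, i ∉ xiUV Φ n u v →
      resSet (Set.subset_univ (segLe i)) (X n u) ∩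
        resSet (Set.subset_univ (segLe i)) (X n v) = ∅)

/-- `F` is reducible to `ξ` on `X`. -/
def Reducible {β : Type*} (F : (↥(Set.univ : Set I) → Cantor) → β) (ξ : Set I)
    (X : Set (↥(Set.univ : Set I) → Cantor)) : Prop :=
  ∀ x ∈ X, ∀ y ∈ X,
    restrictFn (Set.subset_univ ξ) x = restrictFn (Set.subset_univ ξ) y → F x = F y

/-- `F` captures `i` on `X`. -/
def Captures {β : Type*} (F : (↥(Set.univ : Set I) → Cantor) → β) (i : I)
    (X : Set (↥(Set.univ : Set I) → Cantor)) : Prop :=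
  ∀ x ∈ X, ∀ y ∈ X, F x = F y → x ⟨i, Set.mem_univ i⟩ = y ⟨i, Set.mem_univ i⟩

/-- Borel sets of finite level: level `0` = closed sets, level `n+1` = countable
unions or countable intersections of sets of level `n`. -/
def BorelLevel {α : Type*} [TopologicalSpace α] : ℕ → Set (Set α)
  | 0 => {C | IsClosed C}
  | n + 1 =>
      {S | (∃ f : ℕ → Set α, (∀ k, f k ∈ BorelLevel n) ∧ S = ⋃ k, f k) ∨
           (∃ f : ℕ → Set α, (∀ k, f k ∈ BorelLevel n) ∧ S = ⋂ k, f k)}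

end

section
variable {I : Type}

lemma restrictFn_eq_iff {ξ η : Set I} (h : ξ ⊆ η) {x y : ↥η → Cantor} :
    restrictFn h x = restrictFn h y ↔ ∀ j (hj : j ∈ ξ), x ⟨j, h hj⟩ = y ⟨j, h hj⟩ :=
  ⟨fun e j hj => congrFun e ⟨j, hj⟩, fun e => funext fun j => e j.1 j.2⟩

lemma restrictFn_eq_mono {ξ ξ' η : Set I} (h : ξ ⊆ η) (h' : ξ' ⊆ η) (hs : ξ' ⊆ ξ)
    {x y : ↥η → Cantor} (e : restrictFn h x = restrictFn h y) :
    restrictFn h' x = restrictFn h' y :=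
  (restrictFn_eq_iff h').2 fun j hj => (restrictFn_eq_iff h).1 e j (hs hj)

lemma continuous_restrictFn {ξ η : Set I} (h : ξ ⊆ η) :
    Continuous (restrictFn h : (↥η → Cantor) → ↥ξ → Cantor) :=
  continuous_pi fun _ => continuous_apply _

lemma relOpen_iff_mem_nhdsWithin {α : Type*} [TopologicalSpace α] {A B : Set α} (hAB : A ⊆ B) :
    RelOpen A B ↔ ∀ z ∈ A, A ∈ nhdsWithin z B := by
  constructor
  · rintro ⟨U, hU, rfl⟩ z hz
    exact Filter.inter_mem (mem_nhdsWithin_of_mem_nhds (hU.mem_nhds hz.1)) self_mem_nhdsWithin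
  · intro h
    choose! u hu hzu hsub using fun z hz => mem_nhdsWithin.1 (h z hz)
    refine ⟨⋃ z ∈ A, u z, isOpen_biUnion hu, Subset.antisymm ?_ ?_⟩
    · exact fun z hz => ⟨mem_biUnion hz (hzu z hz), hAB hz⟩
    · rintro w ⟨hw, hwB⟩
      obtain ⟨z, hz, hwz⟩ := mem_iUnion₂.1 hw
      exact hsub z hz ⟨hwz, hwB⟩

lemma exists_apply_stem_eq {A : Set Cantor} (hA : A.Nontrivial) (e : Bool) :
    ∃ a ∈ A, a (stem A) = e := by
  have hne : {n | ∃ a ∈ A, ∃ b ∈ A, a n ≠ b n}.Nonempty := by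
    obtain ⟨a, ha, b, hb, hab⟩ := hA
    obtain ⟨n, hn⟩ := Function.ne_iff.1 hab
    exact ⟨n, a, ha, b, hb, hn⟩
  obtain ⟨a, ha, b, hb, hab⟩ := Nat.sInf_mem hne
  change a (stem A) ≠ b (stem A) at hab
  by_cases h : a (stem A) = e
  · exact ⟨a, ha, h⟩
  · refine ⟨b, hb, ?_⟩
    revert hab h
    cases a (stem A) <;> cases b (stem A) <;> cases e <;> simp

lemma Perfect.nontrivial_of_nonempty {A : Set Cantor} (hA : Perfect A) (hne : A.Nonempty) :
    A.Nontrivial := by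
  obtain ⟨a, ha⟩ := hne
  obtain ⟨b, hb, hba⟩ := accPt_iff_nhds.1 (hA.acc a ha) univ Filter.univ_mem
  exact ⟨b, hb.2, a, ha, hba⟩

lemma stem_eq_of_forall_le {A B : Set Cantor} (hB : B.Nontrivial)
    (h : ∀ k ≤ stem B, ∀ e : Bool, (∃ a ∈ A, a k = e) ↔ ∃ b ∈ B, b k = e) :
    stem A = stem B := by
  have key : ∀ k ≤ stem B,
      (∃ a ∈ A, ∃ b ∈ A, a k ≠ b k) ↔ ∃ a ∈ B, ∃ b ∈ B, a k ≠ b k := by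
    intro k hk
    constructor
    · rintro ⟨a, ha, b, hb, hab⟩
      obtain ⟨a', ha', e₁⟩ := (h k hk _).1 ⟨a, ha, rfl⟩
      obtain ⟨b', hb', e₂⟩ := (h k hk _).1 ⟨b, hb, rfl⟩
      exact ⟨a', ha', b', hb', by rwa [e₁, e₂]⟩
    · rintro ⟨a, ha, b, hb, hab⟩
      obtain ⟨a', ha', e₁⟩ := (h k hk _).2 ⟨a, ha, rfl⟩
      obtain ⟨b', hb', e₂⟩ := (h k hk _).2 ⟨b, hb, rfl⟩
      exact ⟨a', ha', b', hb', by rwa [e₁, e₂]⟩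
  have hmem : ∃ a ∈ B, ∃ b ∈ B, a (stem B) ≠ b (stem B) := by
    obtain ⟨a, ha, e₁⟩ := exists_apply_stem_eq hB false
    obtain ⟨b, hb, e₂⟩ := exists_apply_stem_eq hB true
    exact ⟨a, ha, b, hb, by simp [e₁, e₂]⟩
  have hle : stem A ≤ stem B := Nat.sInf_le ((key _ le_rfl).2 hmem)
  refine le_antisymm hle (Nat.sInf_le ((key _ hle).1 ?_))
  exact Nat.sInf_mem (s := {n | ∃ a ∈ A, ∃ b ∈ A, a n ≠ b n}) ⟨_, (key _ le_rfl).2 hmem⟩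

lemma isClopen_setOf_apply_eq (n : ℕ) (e : Bool) : IsClopen {c : Cantor | c n = e} :=
  (isClopen_discrete {e}).preimage (continuous_apply n)

lemma resSet_resSet {η ξ ζ : Set I} (h : η ⊆ ξ) (hsub : ξ ⊆ ζ) {X : Set (↥ζ → Cantor)} :
    resSet h (resSet hsub X) = resSet (h.trans hsub) X := by
  simp only [resSet, image_image]
  rfl

lemma exists_forall_exists_ge_eq {T : Set I} (hT : T.Countable) (hne : T.Nonempty) :
    ∃ g : ℕ → I, (∀ n, g n ∈ T) ∧ ∀ i ∈ T, ∀ N, ∃ n, N ≤ n ∧ g n = i := by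
  obtain ⟨f, rfl⟩ := hT.exists_eq_range hne
  refine ⟨fun n => f n.unpair.1, fun n => mem_range_self _, ?_⟩
  rintro _ ⟨k, rfl⟩ N
  exact ⟨Nat.pair k N, Nat.right_le_pair k N, by simp⟩

lemma Admissible.interleave {ξ ζ : Set I} (hsub : ξ ⊆ ζ) {Φ g : ℕ → I} (hΦ : Admissible ξ Φ)
    (hg : Admissible (ζ \ ξ) g) :
    Admissible ζ fun n => if n % 2 = 0 then Φ (n / 2) else g (n / 2) := by
  constructor
  · intro n
    dsimp only
    split_ifs
    · exact hsub (hΦ.1 _)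
    · exact (hg.1 _).1
  · intro i hi N
    by_cases h : i ∈ ξ
    · obtain ⟨n, hn, rfl⟩ := hΦ.2 i h N
      exact ⟨2 * n, by omega, by simp⟩
    · obtain ⟨n, hn, rfl⟩ := hg.2 i ⟨hi, h⟩ N
      refine ⟨2 * n + 1, by omega, ?_⟩
      have h₁ : (2 * n + 1) % 2 = 1 := by omega
      have h₂ : (2 * n + 1) / 2 = n := by omega
      simp [h₁, h₂]

variable [PartialOrder I]

lemma isLowerSet_seg (i : I) : IsLowerSet (seg i) :=
  fun _ _ hba ha => lt_of_le_of_lt hba ha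

section Projection
variable {ζ ξ : Set I} (hζ : IsLowerSet ζ) (hξ : IsLowerSet ξ) (hsub : ξ ⊆ ζ)
  {X : Set (↥ζ → Cantor)}

lemma Dxz_resSet {i : I} (hi : i ∈ ξ) (z : ↥(seg i) → Cantor) :
    Dxz (resSet hsub X) hi (seg_subset hξ hi) z =
      Dxz X (hsub hi) (seg_subset hζ (hsub hi)) z := by
  ext c
  constructor
  · rintro ⟨_, ⟨x, hx, rfl⟩, hz, hc⟩
    exact ⟨x, hx, hz, hc⟩
  · rintro ⟨x, hx, hz, hc⟩
    exact ⟨_, ⟨x, hx, rfl⟩, hz, hc⟩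

lemma IPe.ipe_resSet (hX : IPe ζ hζ X) : IPe ξ hξ (resSet hsub X) := by
  obtain ⟨⟨hcl, hne⟩, hperf, hopen, hglue⟩ := hX
  refine ⟨⟨(hcl.isCompact.image (continuous_restrictFn hsub)).isClosed, hne.image _⟩,
    ?_, ?_, ?_⟩
  · intro i hi z hz
    rw [resSet_resSet] at hz
    rw [Dxz_resSet hζ hξ]
    exact hperf i (hsub hi) z hz
  · intro i hi G hG
    rw [resSet_resSet]
    convert hopen i (hsub hi) G hG using 1
    ext z
    constructor
    · rintro ⟨_, ⟨x, hx, rfl⟩, hz, hc⟩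
      exact ⟨x, hx, hz, hc⟩
    · rintro ⟨x, hx, hz, hc⟩
      exact ⟨_, ⟨x, hx, rfl⟩, hz, hc⟩
  · intro α β hα hβ hαξ hβξ x hx y hy hxy
    rw [resSet_resSet] at hx hy ⊢
    exact hglue α β hα hβ _ _ x hx y hy hxy

end Projection

variable {ζ : Set I} {hζ : IsLowerSet ζ} {X : Set (↥ζ → Cantor)}

lemma IPe.amalgamate (hX : IPe ζ hζ X) {ξ η : Set I} (hξ : IsLowerSet ξ) (hη : IsLowerSet η)
    (hξζ : ξ ⊆ ζ) (hηζ : η ⊆ ζ) {x y : ↥ζ → Cantor} (hx : x ∈ X) (hy : y ∈ X)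
    (hxy : ∀ j (hj : j ∈ ξ), j ∈ η → x ⟨j, hξζ hj⟩ = y ⟨j, hξζ hj⟩) :
    ∃ w ∈ X, restrictFn hξζ w = restrictFn hξζ x ∧ restrictFn hηζ w = restrictFn hηζ y := by
  obtain ⟨w, hw, hwe⟩ := hX.2.2.2 ξ η hξ hη hξζ hηζ _ ⟨x, hx, rfl⟩ _ ⟨y, hy, rfl⟩
    (funext fun j => hxy j.1 j.2.1 j.2.2)
  refine ⟨w, hw, (restrictFn_eq_iff _).2 fun j hj => ?_, (restrictFn_eq_iff _).2 fun j hj => ?_⟩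
  · have := congrFun hwe ⟨j, Or.inl hj⟩
    simpa [glue, restrictFn, hj] using this
  · have := congrFun hwe ⟨j, Or.inr hj⟩
    by_cases hjξ : j ∈ ξ
    · rw [← hxy j hjξ hj]
      simpa [glue, restrictFn, hjξ] using this
    · simpa [glue, restrictFn, hjξ] using this

lemma mem_Spl {i : I} {hi : i ∈ ζ} {e : Bool} {x : ↥ζ → Cantor} :
    x ∈ Spl hζ X hi e ↔ x ∈ X ∧
      x ⟨i, hi⟩ (stem (Dxz X hi (seg_subset hζ hi) (restrictFn (seg_subset hζ hi) x))) = e :=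
  ⟨fun h => ⟨h.1, h.2.2⟩, fun h => ⟨h.1, ⟨x, h.1, rfl, rfl⟩, h.2⟩⟩

lemma Spl_subset {i : I} (hi : i ∈ ζ) (e : Bool) : Spl hζ X hi e ⊆ X := fun _ h => h.1

lemma mem_Spl_of_restrictFn_eq {i : I} {hi : i ∈ ζ} {e : Bool} {x w : ↥ζ → Cantor}
    {ξ : Set I} (hξ : IsLowerSet ξ) (hξζ : ξ ⊆ ζ) (hiξ : i ∈ ξ)
    (hx : x ∈ Spl hζ X hi e) (hw : w ∈ X) (h : restrictFn hξζ w = restrictFn hξζ x) :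
    w ∈ Spl hζ X hi e := by
  rw [mem_Spl] at hx ⊢
  refine ⟨hw, ?_⟩
  rw [restrictFn_eq_mono hξζ (seg_subset hζ hi) (seg_subset hξ hiξ) h,
    (restrictFn_eq_iff hξζ).1 h i hiξ]
  exact hx.2

lemma IPe.nontrivial_Dxz (hX : IPe ζ hζ X) {i : I} (hi : i ∈ ζ) {z : ↥(seg i) → Cantor}
    (hz : z ∈ resSet (seg_subset hζ hi) X) :
    (Dxz X hi (seg_subset hζ hi) z).Nontrivial := by
  refine (hX.2.1 i hi z hz).nontrivial_of_nonempty ?_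
  obtain ⟨x, hx, rfl⟩ := hz
  exact ⟨_, x, hx, rfl, rfl⟩

lemma IPe.exists_mem_Spl (hX : IPe ζ hζ X) {i : I} (hi : i ∈ ζ) (e : Bool)
    {ξ : Set I} (hξ : IsLowerSet ξ) (hξζ : ξ ⊆ ζ) (hiξ : i ∉ ξ)
    {x : ↥ζ → Cantor} (hx : x ∈ X) :
    ∃ y ∈ Spl hζ X hi e, restrictFn hξζ y = restrictFn hξζ x := by
  obtain ⟨_, ⟨y, hy, hyx, rfl⟩, he⟩ :=
    exists_apply_stem_eq (hX.nontrivial_Dxz hi (mem_image_of_mem _ hx)) e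
  rw [← hyx] at he
  have hyS : y ∈ Spl hζ X hi e := mem_Spl.2 ⟨hy, he⟩
  obtain ⟨w, hw, hwx, hwy⟩ := hX.amalgamate hξ (isLowerSet_segLe i) hξζ (segLe_subset hζ hi)
    hx hy fun j hj hji =>
      ((restrictFn_eq_iff _).1 hyx j (lt_of_le_of_ne hji fun h => hiξ (h ▸ hj))).symm
  exact ⟨w, mem_Spl_of_restrictFn_eq (isLowerSet_segLe i) (segLe_subset hζ hi)
    (mem_segLe_self i) hyS hw hwy, hwx⟩

lemma IPe.resSet_Spl_of_notMem (hX : IPe ζ hζ X) {i : I} (hi : i ∈ ζ) (e : Bool)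
    {ξ : Set I} (hξ : IsLowerSet ξ) (hξζ : ξ ⊆ ζ) (hiξ : i ∉ ξ) :
    resSet hξζ (Spl hζ X hi e) = resSet hξζ X := by
  refine Subset.antisymm (image_mono (Spl_subset hi e)) ?_
  rintro _ ⟨x, hx, rfl⟩
  exact hX.exists_mem_Spl hi e hξ hξζ hiξ hx

lemma resSet_Spl_of_mem {ξ : Set I} (hξ : IsLowerSet ξ) (hξζ : ξ ⊆ ζ) {i : I} (hi : i ∈ ξ)
    (e : Bool) :
    resSet hξζ (Spl hζ X (hξζ hi) e) = Spl hξ (resSet hξζ X) hi e := by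
  ext y
  rw [mem_Spl, Dxz_resSet hζ hξ]
  constructor
  · rintro ⟨x, hx, rfl⟩
    exact ⟨⟨x, hx.1, rfl⟩, hx.2.2⟩
  · rintro ⟨⟨x, hx, rfl⟩, h⟩
    exact ⟨x, mem_Spl.2 ⟨hx, h⟩, rfl⟩

lemma IPe.eventually_exists_iff (hX : IPe ζ hζ X) {i : I} (hi : i ∈ ζ) {G : Set Cantor}
    (hG : IsClopen G) (z₀ : ↥(seg i) → Cantor) :
    ∀ᶠ z in nhdsWithin z₀ (resSet (seg_subset hζ hi) X),
      ((∃ c ∈ Dxz X hi (seg_subset hζ hi) z, c ∈ G) ↔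
        ∃ c ∈ Dxz X hi (seg_subset hζ hi) z₀, c ∈ G) := by
  have hiff : ∀ z, (∃ c ∈ Dxz X hi (seg_subset hζ hi) z, c ∈ G) ↔
      z ∈ restrictFn (seg_subset hζ hi) '' (X ∩ (fun x => x ⟨i, hi⟩) ⁻¹' G) := by
    intro z
    constructor
    · rintro ⟨_, ⟨x, hx, hz, rfl⟩, hc⟩
      exact ⟨x, ⟨hx, hc⟩, hz⟩
    · rintro ⟨x, ⟨hx, hc⟩, hz⟩
      exact ⟨_, ⟨x, hx, hz, rfl⟩, hc⟩
  simp only [hiff]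
  by_cases h : z₀ ∈ restrictFn (seg_subset hζ hi) '' (X ∩ (fun x => x ⟨i, hi⟩) ⁻¹' G)
  · simp only [h, iff_true]
    have hsub : {z | ∃ x ∈ X, x ⟨i, hi⟩ ∈ G ∧ restrictFn (seg_subset hζ hi) x = z} ⊆
        resSet (seg_subset hζ hi) X := by
      rintro _ ⟨x, hx, -, rfl⟩
      exact mem_image_of_mem _ hx
    obtain ⟨x₀, ⟨hx₀, hc₀⟩, hxz⟩ := h
    filter_upwards [(relOpen_iff_mem_nhdsWithin hsub).1 (hX.2.2.1 i hi G hG.isOpen) z₀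
      ⟨x₀, hx₀, hc₀, hxz⟩]
    rintro z ⟨x, hx, hc, hz⟩
    exact ⟨x, ⟨hx, hc⟩, hz⟩
  · simp only [h, iff_false]
    have hcl : IsClosed (restrictFn (seg_subset hζ hi) '' (X ∩ (fun x => x ⟨i, hi⟩) ⁻¹' G)) :=
      ((hX.1.1.inter (hG.isClosed.preimage (continuous_apply _))).isCompact.image
        (continuous_restrictFn _)).isClosed
    exact mem_nhdsWithin_of_mem_nhds (hcl.isOpen_compl.mem_nhds h)

lemma IPe.eventually_stem_eq (hX : IPe ζ hζ X) {i : I} (hi : i ∈ ζ)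
    {z₀ : ↥(seg i) → Cantor} (hz₀ : z₀ ∈ resSet (seg_subset hζ hi) X) :
    ∀ᶠ z in nhdsWithin z₀ (resSet (seg_subset hζ hi) X),
      stem (Dxz X hi (seg_subset hζ hi) z) = stem (Dxz X hi (seg_subset hζ hi) z₀) := by
  have h : ∀ᶠ z in nhdsWithin z₀ (resSet (seg_subset hζ hi) X),
      ∀ k ∈ Set.Iic (stem (Dxz X hi (seg_subset hζ hi) z₀)), ∀ e : Bool,
        ((∃ c ∈ Dxz X hi (seg_subset hζ hi) z, c k = e) ↔
          ∃ c ∈ Dxz X hi (seg_subset hζ hi) z₀, c k = e) := by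
    refine (Filter.eventually_all_finite (Set.finite_Iic _)).2 fun k _ =>
      Filter.eventually_all.2 fun e => ?_
    exact hX.eventually_exists_iff hi (isClopen_setOf_apply_eq k e) z₀
  filter_upwards [h] with z hz
  exact stem_eq_of_forall_le (hX.nontrivial_Dxz hi hz₀) hz

lemma IPe.isClosed_Spl (hX : IPe ζ hζ X) {i : I} (hi : i ∈ ζ) (e : Bool) :
    IsClosed (Spl hζ X hi e) := by
  have hcont : ContinuousOn (fun x : ↥ζ → Cantor => x ⟨i, hi⟩
      (stem (Dxz X hi (seg_subset hζ hi) (restrictFn (seg_subset hζ hi) x)))) X := by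
    intro x hx
    have ht : Filter.Tendsto (restrictFn (seg_subset hζ hi)) (nhdsWithin x X)
        (nhdsWithin (restrictFn (seg_subset hζ hi) x) (resSet (seg_subset hζ hi) X)) :=
      (continuous_restrictFn _).continuousWithinAt.tendsto_nhdsWithin (mapsTo_image _ _)
    have hev := ht.eventually (hX.eventually_stem_eq hi (mem_image_of_mem _ hx))
    refine ContinuousWithinAt.congr_of_eventuallyEq (f := fun y : ↥ζ → Cantor => y ⟨i, hi⟩
      (stem (Dxz X hi (seg_subset hζ hi) (restrictFn (seg_subset hζ hi) x)))) ?_ ?_ rfl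
    · exact ((continuous_apply _).comp (continuous_apply _)).continuousWithinAt
    · filter_upwards [hev] with y hy
      rw [hy]
  convert hcont.preimage_isClosed_of_isClosed hX.1.1 (isClosed_discrete {e}) using 1
  ext x
  exact mem_Spl

lemma exists_congr_of_resSet_segLe_eq {Y : Set (↥ζ → Cantor)} {j : I} (hj : j ∈ ζ)
    (h : resSet (segLe_subset hζ hj) Y = resSet (segLe_subset hζ hj) X)
    (P : Cantor → (↥(seg j) → Cantor) → Prop) :
    (∃ x ∈ Y, P (x ⟨j, hj⟩) (restrictFn (seg_subset hζ hj) x)) ↔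
      ∃ x ∈ X, P (x ⟨j, hj⟩) (restrictFn (seg_subset hζ hj) x) := by
  have key : ∀ Z : Set (↥ζ → Cantor),
      (∃ x ∈ Z, P (x ⟨j, hj⟩) (restrictFn (seg_subset hζ hj) x)) ↔
        ∃ y ∈ resSet (segLe_subset hζ hj) Z,
          P (y ⟨j, mem_segLe_self j⟩) (restrictFn (seg_subset_segLe j) y) :=
    fun Z => (exists_mem_image (f := restrictFn (segLe_subset hζ hj))
      (p := fun y => P (y ⟨j, mem_segLe_self j⟩) (restrictFn (seg_subset_segLe j) y))).symm
  rw [key, key, h]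

lemma Dxz_Spl_self {i : I} (hi : i ∈ ζ) (e : Bool) (z : ↥(seg i) → Cantor) :
    Dxz (Spl hζ X hi e) hi (seg_subset hζ hi) z =
      SplD (Dxz X hi (seg_subset hζ hi) z) e := by
  ext c
  constructor
  · rintro ⟨x, hx, rfl, rfl⟩
    exact hx.2
  · rintro ⟨⟨x, hx, rfl, rfl⟩, h⟩
    exact ⟨x, mem_Spl.2 ⟨hx, h⟩, rfl, rfl⟩

lemma perfect_SplD {A : Set Cantor} (hA : Perfect A) (e : Bool) : Perfect (SplD A e) := by
  have hc := isClopen_setOf_apply_eq (stem A) e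
  refine ⟨hA.closed.inter hc.isClosed, ?_⟩
  have := hA.acc.open_inter hc.isOpen
  rwa [inter_comm] at this

lemma IPe.perfect_Dxz_Spl (hX : IPe ζ hζ X) {i : I} (hi : i ∈ ζ) (e : Bool) {j : I} (hj : j ∈ ζ)
    {z : ↥(seg j) → Cantor} (hz : z ∈ resSet (seg_subset hζ hj) (Spl hζ X hi e)) :
    Perfect (Dxz (Spl hζ X hi e) hj (seg_subset hζ hj) z) := by
  have hzX := image_mono (Spl_subset hi e) hz
  have hp := hX.2.1 j hj z hzX
  by_cases hle : i ≤ j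
  · rcases hle.eq_or_lt with rfl | hlt
    · rw [Dxz_Spl_self]
      exact perfect_SplD hp e
    · convert hp using 1
      ext c
      constructor
      · rintro ⟨x, hx, h⟩
        exact ⟨x, hx.1, h⟩
      · rintro ⟨x, hx, h⟩
        obtain ⟨y, hy, hyz⟩ := hz
        exact ⟨x, mem_Spl_of_restrictFn_eq (isLowerSet_seg j) (seg_subset hζ hj) hlt hy hx
          (h.1.trans hyz.symm), h⟩
  · convert hp using 1
    ext c
    exact exists_congr_of_resSet_segLe_eq (hζ := hζ) hj
      (hX.resSet_Spl_of_notMem hi e (isLowerSet_segLe j) (segLe_subset hζ hj) hle)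
      (fun a w => w = z ∧ a = c)

lemma IPe.relOpen_Spl (hX : IPe ζ hζ X) {i : I} (hi : i ∈ ζ) (e : Bool) {j : I} (hj : j ∈ ζ)
    {G : Set Cantor} (hG : IsOpen G) :
    RelOpen {z | ∃ x ∈ Spl hζ X hi e, x ⟨j, hj⟩ ∈ G ∧ restrictFn (seg_subset hζ hj) x = z}
      (resSet (seg_subset hζ hj) (Spl hζ X hi e)) := by
  have hsubset : ∀ (Y : Set (↥ζ → Cantor)) (G : Set Cantor),
      {z | ∃ x ∈ Y, x ⟨j, hj⟩ ∈ G ∧ restrictFn (seg_subset hζ hj) x = z} ⊆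
        resSet (seg_subset hζ hj) Y := by
    rintro Y G _ ⟨x, hx, -, rfl⟩
    exact mem_image_of_mem _ hx
  have hres : resSet (seg_subset hζ hj) (Spl hζ X hi e) ⊆ resSet (seg_subset hζ hj) X :=
    image_mono (Spl_subset hi e)
  by_cases hle : i ≤ j
  · rw [relOpen_iff_mem_nhdsWithin (hsubset _ _)]
    rintro _ ⟨x, hx, hxG, rfl⟩
    rcases hle.eq_or_lt with rfl | hlt
    · have hxX := hx.1
      have hnhds := (relOpen_iff_mem_nhdsWithin (hsubset X _)).1
        (hX.2.2.1 i hi _ (hG.inter (isClopen_setOf_apply_eq _ e).isOpen)) _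
        ⟨x, hxX, ⟨hxG, (mem_Spl.1 hx).2⟩, rfl⟩
      filter_upwards [nhdsWithin_mono _ hres hnhds, nhdsWithin_mono _ hres
        (hX.eventually_stem_eq hi (mem_image_of_mem _ hxX))]
      rintro _ ⟨y, hy, ⟨hyG, hye⟩, rfl⟩ hstem
      have hstem : stem (Dxz X hi _ (restrictFn (seg_subset hζ hi) y)) = _ := hstem
      refine ⟨y, mem_Spl.2 ⟨hy, ?_⟩, hyG, rfl⟩
      rw [hstem]
      exact hye
    · have hnhds := (relOpen_iff_mem_nhdsWithin (hsubset X _)).1 (hX.2.2.1 j hj G hG) _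
        ⟨x, hx.1, hxG, rfl⟩
      filter_upwards [nhdsWithin_mono _ hres hnhds, self_mem_nhdsWithin]
      rintro _ ⟨y, hy, hyG, rfl⟩ ⟨v, hv, hvy⟩
      exact ⟨y, mem_Spl_of_restrictFn_eq (isLowerSet_seg j) (seg_subset hζ hj) hlt hv hy
        hvy.symm, hyG, rfl⟩
  · rw [hX.resSet_Spl_of_notMem hi e (isLowerSet_seg j) (seg_subset hζ hj)
      fun h => hle (le_of_lt h)]
    convert hX.2.2.1 j hj G hG using 1
    ext z
    exact exists_congr_of_resSet_segLe_eq (hζ := hζ) hj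
      (hX.resSet_Spl_of_notMem hi e (isLowerSet_segLe j) (segLe_subset hζ hj) hle)
      (fun a w => a ∈ G ∧ w = z)

lemma IPe.ipe_Spl (hX : IPe ζ hζ X) {i : I} (hi : i ∈ ζ) (e : Bool) :
    IPe ζ hζ (Spl hζ X hi e) := by
  refine ⟨⟨hX.isClosed_Spl hi e, ?_⟩, fun j hj z hz => hX.perfect_Dxz_Spl hi e hj hz,
    fun j hj G hG => hX.relOpen_Spl hi e hj hG, ?_⟩
  · obtain ⟨x, hx⟩ := hX.1.2
    obtain ⟨y, hy, -⟩ := hX.exists_mem_Spl hi e (isLowerSet_seg i) (seg_subset hζ hi)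
      (lt_irrefl i) hx
    exact ⟨y, hy⟩
  · intro ξ η hξ hη hξζ hηζ _ hx _ hy hxy
    have hglue := hX.2.2.2 ξ η hξ hη hξζ hηζ _ (image_mono (Spl_subset hi e) hx) _
      (image_mono (Spl_subset hi e) hy) hxy
    by_cases hiU : i ∈ ξ ∪ η
    · obtain ⟨x, hx, rfl⟩ := hx
      obtain ⟨y, hy, rfl⟩ := hy
      obtain ⟨w, hw, hwe⟩ := hglue
      refine ⟨w, ?_, hwe⟩
      rcases hiU with h | h
      · refine mem_Spl_of_restrictFn_eq hξ hξζ h hx hw ((restrictFn_eq_iff _).2 fun j hj => ?_)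
        have := congrFun hwe ⟨j, Or.inl hj⟩
        simpa [glue, restrictFn, hj] using this
      · refine mem_Spl_of_restrictFn_eq hη hηζ h hy hw ((restrictFn_eq_iff _).2 fun j hj => ?_)
        have hwj := congrFun hwe ⟨j, Or.inr hj⟩
        by_cases hjξ : j ∈ ξ
        · have hxyj : x ⟨j, hξζ hjξ⟩ = y ⟨j, hξζ hjξ⟩ := congrFun hxy ⟨j, hjξ, hj⟩
          rw [← hxyj]
          simpa [glue, restrictFn, hjξ] using hwj
        · simpa [glue, restrictFn, hjξ] using hwj
    · rwa [hX.resSet_Spl_of_notMem hi e (hξ.union hη) (union_subset hξζ hηζ) hiU]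

lemma IPe.ipe_XPhi (hX : IPe ζ hζ X) {Φ : ℕ → I} (hΦ : ∀ n, Φ n ∈ ζ) (a : ℕ → Bool) (m : ℕ) :
    IPe ζ hζ (XPhi hζ Φ hΦ X m fun k => a k.1) := by
  induction m with
  | zero => exact hX
  | succ m ih => exact ih.ipe_Spl (hΦ m) (a m)

lemma antitone_XPhi {Φ : ℕ → I} (hΦ : ∀ n, Φ n ∈ ζ) (a : ℕ → Bool) :
    Antitone fun m => XPhi hζ Φ hΦ X m fun k => a k.1 :=
  antitone_nat_of_succ_le fun m => Spl_subset (hΦ m) (a m)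

lemma IPe.resSet_XPhi_interleave (hX : IPe ζ hζ X) {ξ : Set I} (hξ : IsLowerSet ξ)
    (hsub : ξ ⊆ ζ) {Φ Ψ : ℕ → I} (hΦ : ∀ n, Φ n ∈ ξ) (hΨ : ∀ n, Ψ n ∈ ζ)
    (heven : ∀ n, Ψ (2 * n) = Φ n) (hodd : ∀ n, Ψ (2 * n + 1) ∉ ξ) (a : ℕ → Bool) (m : ℕ) :
    resSet hsub (XPhi hζ Ψ hΨ X (2 * m) fun k => a (k.1 / 2)) =
      XPhi hξ Φ hΦ (resSet hsub X) m fun k => a k.1 := by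
  induction m with
  | zero => rfl
  | succ m ih =>
    have hIPe := hX.ipe_XPhi hΨ (fun k => a (k / 2)) (2 * m)
    have hstep : ∀ (i : I) (hi : i ∈ ζ) (hiΦ : i = Φ m) (e : Bool), e = a m →
        resSet hsub (Spl hζ
          (XPhi hζ Ψ hΨ X (2 * m) fun k => a (k.1 / 2)) hi e) =
        Spl hξ (XPhi hξ Φ hΦ (resSet hsub X) m fun k => a k.1)
          (hΦ m) (a m) := by
      rintro _ hi rfl _ rfl
      rw [resSet_Spl_of_mem hξ hsub (hΦ m), ih]
    exact ((hIPe.ipe_Spl (hΨ (2 * m)) (a (2 * m / 2))).resSet_Spl_of_notMem (hΨ (2 * m + 1)) _ hξ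
      hsub (hodd m)).trans (hstep _ _ (heven m) _ (by simp))

lemma Shrinkable.resSet_of_nonempty_diff [Countable I] (hX : IPe ζ hζ X)
    (hS : Shrinkable hζ X) {ξ : Set I} (hξ : IsLowerSet ξ) (hsub : ξ ⊆ ζ)
    (hne : (ζ \ ξ).Nonempty) : Shrinkable hξ (resSet hsub X) := by
  intro Φ hΦ a
  obtain ⟨g, hg⟩ := exists_forall_exists_ge_eq (to_countable (ζ \ ξ)) hne
  have hΨ := hΦ.interleave hsub hg
  obtain ⟨x, hx⟩ := hS _ hΨ fun k => a (k / 2)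
  have key := hX.resSet_XPhi_interleave hξ hsub hΦ.1 hΨ.1 (fun n => by simp)
    (fun n => by
      have h₁ : (2 * n + 1) % 2 = 1 := by omega
      simpa [h₁] using (hg.1 _).2) a
  have hanti := antitone_XPhi (hζ := hζ) (X := X) hΨ.1 fun k => a (k / 2)
  refine ⟨restrictFn hsub x, Subset.antisymm (fun y hy => ?_) ?_⟩
  · have hclosed : ∀ m, IsClosed (XPhi hζ _ hΨ.1 X (2 * m) (fun k => a (k.1 / 2)) ∩
        restrictFn hsub ⁻¹' {y}) := fun m =>
      (hX.ipe_XPhi hΨ.1 (fun k => a (k / 2)) _).1.1.inter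
        (isClosed_singleton.preimage (continuous_restrictFn hsub))
    obtain ⟨w, hw⟩ := IsCompact.nonempty_iInter_of_sequence_nonempty_isCompact_isClosed _
      (fun m => inter_subset_inter_left _ (hanti (by omega : 2 * m ≤ 2 * (m + 1))))
      (fun m => by
        have hym := mem_iInter.1 hy m
        rw [← key m] at hym
        obtain ⟨v, hv, hvy⟩ := hym
        exact ⟨v, hv, hvy⟩)
      (hclosed 0).isCompact hclosed
    rw [mem_iInter] at hw
    have hwx : w ∈ ({x} : Set (↥ζ → Cantor)) := by
      rw [← hx]
      exact mem_iInter.2 fun m => hanti (by omega : m ≤ 2 * m) (hw m).1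
    rw [← mem_singleton_iff.1 hwx]
    exact (hw 0).2.symm
  · rintro _ rfl
    refine mem_iInter.2 fun m => ?_
    rw [← key m]
    have hxm : x ∈ ⋂ m, XPhi hζ _ hΨ.1 X m fun k => a (k.1 / 2) := hx ▸ mem_singleton x
    exact mem_image_of_mem _ (mem_iInter.1 hxm (2 * m))

end

theorem stmt5 (I : Type) [PartialOrder I] [Countable I]
    (ζ : Set I) (hζ : IsLowerSet ζ)
    (X : Set (↥ζ → Cantor)) (hX : Pe ζ hζ X)
    (ξ : Set I) (hξ : IsLowerSet ξ) (hsub : ξ ⊆ ζ) :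
    Pe ξ hξ (resSet hsub X) := by
  rcases (ζ \ ξ).eq_empty_or_nonempty with h | h
  · obtain rfl := hsub.antisymm (sdiff_eq_empty.1 h)
    have hres : resSet hsub X = X := image_id X
    rwa [hres]
  · exact ⟨hX.1.ipe_resSet hζ hξ hsub, hX.2.resSet_of_nonempty_diff hX.1 hξ hsub h⟩
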